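/- arXiv:1311.2443 — 6 statements merged into one kernel-verified Lean document; each statement's English description precedes it below -/
import Mathlib

section
/- Theorem 2(ii): Let n : ℤ be even, let a₁, b₁ : ℝ → ℝ be continuous with a₁ odd and b₁ even, let d₁ ≠ 0, and let I ⊆ ℝ be an open set containing 0 that is symmetric about 0 (t ∈ I ↔ −t ∈ I). Suppose y₁ : ℝ → ℝ satisfies HasDerivAt y₁ (a₁ t · y₁ t + b₁ t · (y₁ t)^n) t for all t ∈ I and y₁ 0 = d₁. Then z : ℝ → ℝ defined by z t = −y₁(−t) satisfies HasDerivAt z (a₁ t · z t + b₁ t · (z t)^n) t for all t ∈ I and z 0 = −d₁. (Hence y₁ and the solution y₂ of the same Bernoulli equation with initial value d₂ = −d₁ are symmetric to each other with respect to the origin.) -/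
theorem theorem2_ii (n : ℤ) (hn : Even n) (a₁ b₁ : ℝ → ℝ)
    (ha₁ : Continuous a₁) (hb₁ : Continuous b₁)
    (haOdd : ∀ t, a₁ (-t) = -a₁ t) (hbEven : ∀ t, b₁ (-t) = b₁ t)
    (d₁ : ℝ) (hd₁ : d₁ ≠ 0)
    (I : Set ℝ) (hI : IsOpen I) (h0 : (0:ℝ) ∈ I) (hIsym : ∀ t, t ∈ I ↔ -t ∈ I)
    (y₁ : ℝ → ℝ)
    (hode : ∀ t ∈ I, HasDerivAt y₁ (a₁ t * y₁ t + b₁ t * (y₁ t) ^ n) t)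
    (hinit : y₁ 0 = d₁) :
    (∀ t ∈ I, HasDerivAt (fun s => -y₁ (-s))
        (a₁ t * (-y₁ (-t)) + b₁ t * (-y₁ (-t)) ^ n) t) ∧
      (fun s => -y₁ (-s)) 0 = -d₁ := by
  refine ⟨fun t ht => ?_, by simp [hinit]⟩
  have h := ((hode (-t) ((hIsym t).mp ht)).scomp t (hasDerivAt_neg t)).neg
  refine h.congr_deriv ?_
  rw [haOdd, hbEven, hn.neg_zpow, smul_eq_mul]
  ring
end

section
/- Theorem 2(iii): Let n : ℤ be even, let a₁, b₁ : ℝ → ℝ be continuous and both even, let d₁ ≠ 0, and let I ⊆ ℝ be an open set containing 0 that is symmetric about 0 (t ∈ I ↔ −t ∈ I). Suppose y₁ : ℝ → ℝ satisfies HasDerivAt y₁ (a₁ t · y₁ t + b₁ t · (y₁ t)^n) t for all t ∈ I and y₁ 0 = d₁. Then z : ℝ → ℝ defined by z t = −y₁(−t) satisfies HasDerivAt z ((−a₁ t) · z t + b₁ t · (z t)^n) t for all t ∈ I and z 0 = −d₁. (Hence y₁ and the solution y₂ of the Bernoulli problem with a₂ = −a₁, b₂ = b₁, d₂ = −d₁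 are symmetric to each other with respect to the origin.) -/
theorem theorem2_iii (n : ℤ) (hn : Even n) (a₁ b₁ : ℝ → ℝ)
    (ha₁ : Continuous a₁) (hb₁ : Continuous b₁)
    (haEven : ∀ t, a₁ (-t) = a₁ t) (hbEven : ∀ t, b₁ (-t) = b₁ t)
    (d₁ : ℝ) (hd₁ : d₁ ≠ 0)
    (I : Set ℝ) (hI : IsOpen I) (h0 : (0:ℝ) ∈ I) (hIsym : ∀ t, t ∈ I ↔ -t ∈ I)
    (y₁ : ℝ → ℝ)
    (hode : ∀ t ∈ I, HasDerivAt y₁ (a₁ t * y₁ t + b₁ t * (y₁ t) ^ n) t)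
    (hinit : y₁ 0 = d₁) :
    (∀ t ∈ I, HasDerivAt (fun s => -y₁ (-s))
        ((-a₁ t) * (-y₁ (-t)) + b₁ t * (-y₁ (-t)) ^ n) t) ∧
      (fun s => -y₁ (-s)) 0 = -d₁ := by
  refine ⟨fun t ht => ?_, by simp [hinit]⟩
  have h := ((hode (-t) ((hIsym t).mp ht)).comp t (hasDerivAt_neg t)).neg
  refine h.congr_deriv ?_
  rw [haEven, hbEven, hn.neg_zpow]
  ring
end

section
/- Theorem 3(i): Let n be any real number, let a₁, b₁ : ℝ → ℝ be continuous with a₁ even and b₁ odd, let d₁ > 0, and let I ⊆ ℝ be an open set containing 0, symmetric about 0 (t ∈ I ↔ −t ∈ I). Suppose y₁ : ℝ → ℝ is positive on I and satisfies HasDerivAt y₁ (a₁ t · y₁ t + b₁ t · (y₁ t)^n) t for all t ∈ I (real power, rpow) and y₁ 0 = d₁. Then z : ℝ → ℝ defined by z t = y₁(−t) satisfies HasDerivAt z ((−a₁ t) · z t + b₁ t · (z t)^n) t for all t ∈ I and z 0 = d₁. (Hence y₁ and the solution y₂ of the Bernoulli problem with a₂ = −a₁, b₂ = b₁, d₂ =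 d₁ are symmetric to each other with respect to the y-axis: y₂(−t) = y₁(t).) -/
theorem theorem3_i (n : ℝ) (a₁ b₁ : ℝ → ℝ)
    (ha₁ : Continuous a₁) (hb₁ : Continuous b₁)
    (haEven : ∀ t, a₁ (-t) = a₁ t) (hbOdd : ∀ t, b₁ (-t) = -b₁ t)
    (d₁ : ℝ) (hd₁ : 0 < d₁)
    (I : Set ℝ) (hI : IsOpen I) (h0 : (0:ℝ) ∈ I) (hIsym : ∀ t, t ∈ I ↔ -t ∈ I)
    (y₁ : ℝ → ℝ) (hpos : ∀ t ∈ I, 0 < y₁ t)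
    (hode : ∀ t ∈ I, HasDerivAt y₁ (a₁ t * y₁ t + b₁ t * (y₁ t) ^ n) t)
    (hinit : y₁ 0 = d₁) :
    (∀ t ∈ I, HasDerivAt (fun s => y₁ (-s))
        ((-a₁ t) * y₁ (-t) + b₁ t * (y₁ (-t)) ^ n) t) ∧
      (fun s => y₁ (-s)) 0 = d₁ := by
  refine ⟨fun t ht => ?_, by simpa using hinit⟩
  have h := (hode (-t) ((hIsym t).1 ht)).comp t (hasDerivAt_neg t)
  rw [haEven, hbOdd] at h
  exact h.congr_deriv (by ring)
end

section
/- Theorem 4(i): Let n : ℤ be odd, let a₁, b₁ : ℝ → ℝ be continuous with a₁ odd and b₁ even, let d₁ ≠ 0, and let I ⊆ ℝ be an open set containing 0, symmetric about 0 (t ∈ I ↔ −t ∈ I). Suppose y₁ : ℝ → ℝ satisfies HasDerivAt y₁ (a₁ t · y₁ t + b₁ t · (y₁ t)^n) t for all t ∈ I and y₁ 0 = d₁. Then z : ℝ → ℝ defined by z t = −y₁(−t) satisfies HasDerivAt z (a₁ t · z t + (−b₁ t) · (z t)^n) t for all t ∈ I and z 0 = −d₁. (Hence y₁ and the solution y₂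 of the Bernoulli problem with a₂ = a₁, b₂ = −b₁, d₂ = −d₁ are symmetric to each other with respect to the origin: y₂(−t) = −y₁(t).) -/
theorem theorem4_i (n : ℤ) (hn : Odd n) (a₁ b₁ : ℝ → ℝ)
    (ha₁ : Continuous a₁) (hb₁ : Continuous b₁)
    (haOdd : ∀ t, a₁ (-t) = -a₁ t) (hbEven : ∀ t, b₁ (-t) = b₁ t)
    (d₁ : ℝ) (hd₁ : d₁ ≠ 0)
    (I : Set ℝ) (hI : IsOpen I) (h0 : (0:ℝ) ∈ I) (hIsym : ∀ t, t ∈ I ↔ -t ∈ I)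
    (y₁ : ℝ → ℝ)
    (hode : ∀ t ∈ I, HasDerivAt y₁ (a₁ t * y₁ t + b₁ t * (y₁ t) ^ n) t)
    (hinit : y₁ 0 = d₁) :
    (∀ t ∈ I, HasDerivAt (fun s => -y₁ (-s))
        (a₁ t * (-y₁ (-t)) + (-b₁ t) * (-y₁ (-t)) ^ n) t) ∧
      (fun s => -y₁ (-s)) 0 = -d₁ := by
  refine ⟨fun t ht => ?_, by simp [hinit]⟩
  have h := ((hode (-t) ((hIsym t).1 ht)).scomp t (hasDerivAt_neg t)).neg
  refine h.congr_deriv ?_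
  rw [hn.neg_zpow, haOdd, hbEven, smul_eq_mul]
  ring
end

section
/- Theorem 4(iii): Let n : ℤ be odd, let a₁, b₁ : ℝ → ℝ be continuous with a₁ even and b₁ odd, let d₁ ≠ 0, and let I ⊆ ℝ be an open set containing 0, symmetric about 0 (t ∈ I ↔ −t ∈ I). Suppose y₁ : ℝ → ℝ satisfies HasDerivAt y₁ (a₁ t · y₁ t + b₁ t · (y₁ t)^n) t for all t ∈ I and y₁ 0 = d₁. Then z : ℝ → ℝ defined by z t = −y₁(−t) satisfies HasDerivAt z ((−a₁ t) · z t + b₁ t · (z t)^n) t for all t ∈ I and z 0 = −d₁. (Hence y₁ and the solution y₂ of the Bernoulli problem with a₂ = −a₁, b₂ = b₁, d₂ = −d₁ are symmetric to each other with respect to the origin.) -/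
theorem theorem4_iii (n : ℤ) (hn : Odd n) (a₁ b₁ : ℝ → ℝ)
    (ha₁ : Continuous a₁) (hb₁ : Continuous b₁)
    (haEven : ∀ t, a₁ (-t) = a₁ t) (hbOdd : ∀ t, b₁ (-t) = -b₁ t)
    (d₁ : ℝ) (hd₁ : d₁ ≠ 0)
    (I : Set ℝ) (hI : IsOpen I) (h0 : (0:ℝ) ∈ I) (hIsym : ∀ t, t ∈ I ↔ -t ∈ I)
    (y₁ : ℝ → ℝ)
    (hode : ∀ t ∈ I, HasDerivAt y₁ (a₁ t * y₁ t + b₁ t * (y₁ t) ^ n) t)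
    (hinit : y₁ 0 = d₁) :
    (∀ t ∈ I, HasDerivAt (fun s => -y₁ (-s))
        ((-a₁ t) * (-y₁ (-t)) + b₁ t * (-y₁ (-t)) ^ n) t) ∧
      (fun s => -y₁ (-s)) 0 = -d₁ := by
  refine ⟨fun t ht => ?_, by simp [hinit]⟩
  have hderiv := ((hode (-t) ((hIsym t).1 ht)).comp t (hasDerivAt_neg t)).neg
  refine hderiv.congr_deriv ?_
  rw [hn.neg_zpow, haEven, hbOdd]
  ring
end

section
/- Explicit solution formula (3): Let n be a real number with n ≠ 1, let a, b : ℝ → ℝ be continuous, and let d > 0. Define G : ℝ → ℝ by G t = d^(1−n) − (n−1)·∫_{0}^{t} b(s)·exp((n−1)·∫_{0}^{s} a(r) dr) ds, and define y : ℝ → ℝ by y t = exp(∫_{0}^{t} a(r) dr) · (G t)^(−1/(n−1)) (real powers, rpow). Then y 0 = d, and for every t in any open interval J containing 0 on which G is positive, HasDerivAt y (a t · y t + b t · (y t)^n) t; in particular y is positive on J and solves the Bernoulli initial-value problem y' = a(t)y + b(t)y^n, y(0) = d, on J. -/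
open intervalIntegral Real

theorem explicit_solution_formula (n : ℝ) (hn : n ≠ 1) (a b : ℝ → ℝ)
    (ha : Continuous a) (hb : Continuous b)
    (d : ℝ) (hd : 0 < d)
    (G : ℝ → ℝ)
    (hG : G = fun t => d ^ (1 - n) -
      (n - 1) * ∫ s in (0:ℝ)..t, b s * Real.exp ((n - 1) * ∫ r in (0:ℝ)..s, a r))
    (y : ℝ → ℝ)
    (hy : y = fun t => Real.exp (∫ r in (0:ℝ)..t, a r) * (G t) ^ (-(1 / (n - 1)))) :
    y 0 = d ∧
      ∀ p q : ℝ, p < 0 → 0 < q → (∀ t ∈ Set.Ioo p q, 0 < G t) →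
        (∀ t ∈ Set.Ioo p q, 0 < y t) ∧
          ∀ t ∈ Set.Ioo p q, HasDerivAt y (a t * y t + b t * (y t) ^ n) t := by
  have hn' : n - 1 ≠ 0 := sub_ne_zero.mpr hn
  have hA (t : ℝ) : HasDerivAt (fun t => ∫ r in (0:ℝ)..t, a r) (a t) t :=
    ha.integral_hasStrictDerivAt 0 t |>.hasDerivAt
  have hAc : Continuous fun t => ∫ r in (0:ℝ)..t, a r :=
    continuous_iff_continuousAt.mpr fun t => (hA t).continuousAt
  have hf : Continuous fun s => b s * Real.exp ((n - 1) * ∫ r in (0:ℝ)..s, a r) :=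
    hb.mul (Real.continuous_exp.comp (continuous_const.mul hAc))
  have hGd (t : ℝ) : HasDerivAt G
      (-((n - 1) * (b t * Real.exp ((n - 1) * ∫ r in (0:ℝ)..t, a r)))) t := by
    rw [hG]
    exact ((hf.integral_hasStrictDerivAt 0 t).hasDerivAt.const_mul (n - 1)).const_sub _
  have hpos (t : ℝ) (ht : 0 < G t) : 0 < y t := by
    rw [hy]
    positivity
  refine ⟨?_, fun p q _ _ hGpos => ⟨fun t ht => hpos t (hGpos t ht), fun t ht => ?_⟩⟩
  · have he : (1 - n) * (-(1 / (n - 1))) = 1 := by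
      field_simp
      ring
    simp only [hy, hG, intervalIntegral.integral_same, Real.exp_zero, mul_zero, sub_zero, one_mul]
    rw [← Real.rpow_mul hd.le, he, Real.rpow_one]
  · have hGt := hGpos t ht
    have hyd := (hA t).exp.mul ((hGd t).rpow_const (p := -(1 / (n - 1))) (Or.inl hGt.ne'))
    have hpow : y t ^ n = Real.exp (∫ r in (0:ℝ)..t, a r) *
        Real.exp ((n - 1) * ∫ r in (0:ℝ)..t, a r) * G t ^ (-(1 / (n - 1)) - 1) := by
      have he : -(1 / (n - 1)) * n = -(1 / (n - 1)) - 1 := by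
        field_simp
        ring
      simp only [hy]
      rw [Real.mul_rpow (Real.exp_pos _).le (Real.rpow_nonneg hGt.le _), ← Real.rpow_mul hGt.le, he,
        ← Real.exp_mul, ← Real.exp_add]
      ring_nf
    rw [hpow, hy]
    refine hyd.congr_deriv ?_
    field_simp
end
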